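/- arXiv:1811.07306 — 5 statements merged into one kernel-verified Lean document; each statement's English description precedes it below -/
import Mathlib

section
/- Let P1, P2, P3 be affinely independent points of the Euclidean plane ℝ² and let Δ be the closed triangular region conv{P1,P2,P3}. A point m ∈ ℝ² is the geometric median of Δ (i.e. a global minimizer of Σ_Δ) if and only if (Σ_{P1P2}(m)/‖P2−P1‖)·(P2−P1) + (Σ_{P2P3}(m)/‖P3−P2‖)·(P3−P2) + (Σ_{P3P1}(m)/‖P1−P3‖)·(P1−P3) = 0 as a vector equation in ℝ². -/
open MeasureTheory

/-- The integral of the distance from `X` over the segment from `A` to `B`,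
`Σ_{AB}(X) = ∫_{t ∈ [0,1]} ‖A + t•(B−A) − X‖ · ‖B−A‖ dt`. -/
noncomputable def segInt (A B X : EuclideanSpace ℝ (Fin 2)) : ℝ :=
  ∫ t in (0:ℝ)..1, ‖A + t • (B - A) - X‖ * ‖B - A‖

/-- `Σ_Ω(X) = ∫_{P ∈ Ω} ‖P − X‖ dP` with respect to Lebesgue (area) measure. -/
noncomputable def sigmaSet (Ω : Set (EuclideanSpace ℝ (Fin 2)))
    (X : EuclideanSpace ℝ (Fin 2)) : ℝ :=
  ∫ P in Ω, ‖P - X‖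

/-- The gradient at `X` of the distance to `P` (zero when `X = P`). -/
noncomputable def distGrad {E : Type*} [NormedAddCommGroup E] [NormedSpace ℝ E] (P X : E) : E :=
  ‖P - X‖⁻¹ • (X - P)

section Gradient

variable {E : Type*} [NormedAddCommGroup E] [InnerProductSpace ℝ E]

theorem norm_distGrad_le (P X : E) : ‖distGrad P X‖ ≤ 1 := by
  rw [distGrad, norm_smul, norm_inv, norm_norm, norm_sub_rev X P]
  exact inv_mul_le_one

theorem hasFDerivAt_norm_sub {P X : E} (h : P ≠ X) :
    HasFDerivAt (fun Y => ‖P - Y‖) (innerSL ℝ (distGrad P X)) X := by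
  have hn : ‖P - X‖ ≠ 0 := norm_ne_zero_iff.2 (sub_ne_zero.2 h)
  have h1 : HasFDerivAt (fun Y : E => P - Y) (-ContinuousLinearMap.id ℝ E) X :=
    (hasFDerivAt_id X).const_sub P
  have h2 := h1.norm_sq.sqrt (pow_ne_zero 2 hn)
  simp only [Real.sqrt_sq (norm_nonneg _)] at h2
  convert! h2 using 1
  ext v
  simp only [distGrad, innerSL_apply_apply, inner_smul_left, smul_apply,
    ContinuousLinearMap.comp_apply, neg_apply, ContinuousLinearMap.id_apply,
    inner_neg_right, ← neg_sub P X, inner_neg_left, smul_eq_mul, nsmul_eq_mul]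
  simp
  field_simp

theorem norm_sub_add_inner_distGrad_le (P X Y : E) :
    ‖P - X‖ + inner ℝ (distGrad P X) (Y - X) ≤ ‖P - Y‖ := by
  have h1 : inner ℝ (distGrad P X) (P - X) = -‖P - X‖ := by
    rcases eq_or_ne ‖P - X‖ 0 with h | h
    · simp [distGrad, h]
    · rw [distGrad, ← neg_sub P X, inner_smul_left, inner_neg_left, real_inner_self_eq_norm_sq]
      simp
      field_simp
  have h2 : inner ℝ (distGrad P X) (Y - X) =
      inner ℝ (distGrad P X) (P - X) - inner ℝ (distGrad P X) (P - Y) := by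
    rw [← inner_sub_right]
    congr 1
    abel
  have h3 := (abs_le.1 ((abs_real_inner_le_norm (distGrad P X) (P - Y)).trans
    (mul_le_of_le_one_left (norm_nonneg _) (norm_distGrad_le P X)))).1
  linarith

variable [MeasurableSpace E] [BorelSpace E] [SecondCountableTopology E]

theorem measurable_distGrad (X : E) : Measurable fun P => distGrad P X := by
  unfold distGrad
  fun_prop

theorem integrableOn_distGrad {μ : Measure E} {s : Set E} (hs : μ s ≠ ⊤) (X : E) :
    IntegrableOn (fun P => distGrad P X) s μ :=
  Measure.integrableOn_of_bounded hs (measurable_distGrad X).aestronglyMeasurable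
    (.of_forall fun P => norm_distGrad_le P X)

omit [InnerProductSpace ℝ E] [SecondCountableTopology E] in
theorem integrableOn_norm_sub {μ : Measure E} [IsFiniteMeasureOnCompacts μ] {s : Set E}
    (hs : IsCompact s) (X : E) : IntegrableOn (fun P => ‖P - X‖) s μ :=
  (by fun_prop : Continuous fun P => ‖P - X‖).continuousOn.integrableOn_compact hs

theorem hasFDerivAt_setIntegral_norm_sub [CompleteSpace E] {μ : Measure E} [NullSingletonClass μ]
    [IsFiniteMeasureOnCompacts μ] {s : Set E} (hs : IsCompact s) (X : E) :
    HasFDerivAt (fun Y => ∫ P in s, ‖P - Y‖ ∂μ) (innerSL ℝ (∫ P in s, distGrad P X ∂μ)) X := by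
  have hfin : μ s ≠ ⊤ := hs.measure_lt_top.ne
  rw [← ContinuousLinearMap.integral_comp_comm _ (integrableOn_distGrad hfin X)]
  refine (hasFDerivAt_integral_of_dominated_loc_of_lip (μ := μ.restrict s)
    (F := fun Y P => ‖P - Y‖) (bound := fun _ => 1) (Filter.univ_mem)
    (.of_forall fun Y => by fun_prop) (integrableOn_norm_sub (μ := μ) hs X)
    ((innerSL ℝ).continuous.comp_aestronglyMeasurable
      (measurable_distGrad X).aestronglyMeasurable) (.of_forall fun P => ?_)
    (integrableOn_const hfin) ?_).2
  · refine LipschitzOnWith.of_dist_le_mul fun Y _ Z _ => ?_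
    have h := abs_norm_sub_norm_le (P - Y) (P - Z)
    rw [sub_sub_sub_cancel_left, norm_sub_rev Z Y] at h
    simpa [Real.dist_eq, dist_eq_norm] using h
  · have : ∀ᵐ P ∂μ, P ≠ X := by simp [ae_iff]
    exact (ae_restrict_of_ae this).mono fun P hP => hasFDerivAt_norm_sub hP

theorem setIntegral_norm_sub_minimal_iff [CompleteSpace E] {μ : Measure E} [NullSingletonClass μ]
    [IsFiniteMeasureOnCompacts μ] {s : Set E} (hs : IsCompact s) (X : E) :
    (∀ Y, ∫ P in s, ‖P - X‖ ∂μ ≤ ∫ P in s, ‖P - Y‖ ∂μ) ↔ ∫ P in s, distGrad P X ∂μ = 0 := by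
  have hint := integrableOn_distGrad hs.measure_lt_top.ne X (μ := μ)
  constructor
  · intro h
    have h0 := IsLocalMin.hasFDerivAt_eq_zero (.of_forall h)
      (hasFDerivAt_setIntegral_norm_sub (μ := μ) hs X)
    simpa [innerSL_apply_apply] using DFunLike.congr_fun h0 (∫ P in s, distGrad P X ∂μ)
  · intro h Y
    have hi : IntegrableOn (fun P => inner ℝ (distGrad P X) (Y - X)) s μ := hint.inner_const _
    have h0 : ∫ P in s, inner ℝ (distGrad P X) (Y - X) ∂μ = 0 := by
      simp_rw [real_inner_comm (Y - X)]
      rw [integral_inner hint, h, inner_zero_right]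
    calc ∫ P in s, ‖P - X‖ ∂μ = ∫ P in s, (‖P - X‖ + inner ℝ (distGrad P X) (Y - X)) ∂μ := by
          rw [integral_add (integrableOn_norm_sub hs X) hi, h0, add_zero]
      _ ≤ _ := integral_mono ((integrableOn_norm_sub hs X).add hi) (integrableOn_norm_sub hs Y)
          fun P => norm_sub_add_inner_distGrad_le P X Y

end Gradient

/-- The triangle with vertices `(0, 0)`, `(1, 0)` and `(0, 1)`. -/
def stdTriangle : Set (ℝ × ℝ) := {z | 0 ≤ z.1 ∧ 0 ≤ z.2 ∧ z.1 + z.2 ≤ 1}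

theorem convex_stdTriangle : Convex ℝ stdTriangle := by
  rintro x ⟨hx1, hx2, hx3⟩ y ⟨hy1, hy2, hy3⟩ a b ha hb hab
  refine ⟨?_, ?_, ?_⟩ <;> simp only [Prod.fst_add, Prod.snd_add, Prod.smul_fst, Prod.smul_snd,
    smul_eq_mul]
  · positivity
  · positivity
  · nlinarith

theorem isClosed_stdTriangle : IsClosed stdTriangle :=
  (isClosed_le continuous_const continuous_fst).inter
    ((isClosed_le continuous_const continuous_snd).inter
      (isClosed_le (continuous_fst.add continuous_snd) continuous_const))

theorem stdTriangle_subset_Icc : stdTriangle ⊆ Set.Icc 0 1 := by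
  rintro ⟨x, y⟩ ⟨hx, hy, hxy⟩
  simp only at hx hy hxy
  exact ⟨⟨hx, hy⟩, ⟨by simp; linarith, by simp; linarith⟩⟩

theorem isCompact_stdTriangle : IsCompact stdTriangle :=
  isCompact_Icc.of_isClosed_subset isClosed_stdTriangle stdTriangle_subset_Icc

theorem setIntegral_stdTriangle {f : ℝ × ℝ → ℝ} (hf : IntegrableOn f stdTriangle) :
    ∫ z in stdTriangle, f z = ∫ y in (0:ℝ)..1, ∫ x in (0:ℝ)..(1 - y), f (x, y) := by
  have hm := isClosed_stdTriangle.measurableSet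
  rw [← integral_indicator hm, Measure.volume_eq_prod, integral_prod_symm]
  swap
  · rw [← Measure.volume_eq_prod]
    exact hf.integrable_indicator hm
  rw [intervalIntegral.integral_of_le zero_le_one, ← integral_Icc_eq_integral_Ioc,
    ← integral_indicator measurableSet_Icc]
  congr 1 with y
  by_cases hy : y ∈ Set.Icc (0 : ℝ) 1
  · rw [Set.indicator_of_mem hy, intervalIntegral.integral_of_le (by linarith [hy.2]),
      ← integral_Icc_eq_integral_Ioc, ← integral_indicator measurableSet_Icc]
    congr 1 with x
    have : (x, y) ∈ stdTriangle ↔ x ∈ Set.Icc 0 (1 - y) := by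
      simp [stdTriangle, hy.1, le_sub_iff_add_le]
    simp only [Set.indicator, this]
  · rw [Set.indicator_of_notMem hy]
    refine integral_eq_zero_of_ae (.of_forall fun x => Set.indicator_of_notMem (fun h => hy ?_) _)
    exact ⟨h.2.1, (stdTriangle_subset_Icc h).2.2⟩

theorem convexHull_triple_eq_image {E : Type*} [AddCommGroup E] [Module ℝ E] (A B C : E) :
    convexHull ℝ {A, B, C} =
      (fun z : ℝ × ℝ => A + (z.1 • (B - A) + z.2 • (C - A))) '' stdTriangle := by
  let l : ℝ × ℝ →ₗ[ℝ] E := (LinearMap.fst ℝ ℝ ℝ).smulRight (B - A) +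
    (LinearMap.snd ℝ ℝ ℝ).smulRight (C - A)
  have hl : (fun z : ℝ × ℝ => A + (z.1 • (B - A) + z.2 • (C - A))) '' stdTriangle =
      (fun z => A + z) '' (l '' stdTriangle) := by
    rw [Set.image_image]
    rfl
  refine Set.Subset.antisymm (convexHull_min ?_ ?_) ?_
  · rintro _ (rfl | rfl | rfl)
    · exact ⟨(0, 0), by simp [stdTriangle], by simp⟩
    · exact ⟨(1, 0), by simp [stdTriangle], by simp⟩
    · exact ⟨(0, 1), by simp [stdTriangle], by simp⟩
  · rw [hl]
    exact (convex_stdTriangle.linear_image l).translate A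
  · rintro _ ⟨⟨x, y⟩, ⟨hx, hy, hxy⟩, rfl⟩
    have hA : A ∈ convexHull ℝ {A, B, C} := subset_convexHull _ _ (by simp)
    have hB : B ∈ convexHull ℝ {A, B, C} := subset_convexHull _ _ (by simp)
    have hC : C ∈ convexHull ℝ {A, B, C} := subset_convexHull _ _ (by simp)
    have := (convex_convexHull ℝ {A, B, C}).sum_mem (t := Finset.univ)
      (w := ![1 - x - y, x, y]) (z := ![A, B, C])
      (by intro i _; fin_cases i <;> simp_all; linarith) (by simp [Fin.sum_univ_three]; ring)
      (by intro i _; fin_cases i <;> simp_all)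
    convert this using 1
    simp [Fin.sum_univ_three]
    module

theorem setIntegral_convexHull_triple {E : Type*} [NormedAddCommGroup E] [NormedSpace ℝ E]
    [FiniteDimensional ℝ E] [MeasurableSpace E] [BorelSpace E] (μ : Measure E)
    [μ.IsAddHaarMeasure] (hE : Module.finrank ℝ E = 2) {A B C : E}
    (h : LinearIndependent ℝ ![B - A, C - A]) :
    ∃ c : ℝ, c ≠ 0 ∧ ∀ f : E → ℝ, ∫ P in convexHull ℝ {A, B, C}, f P ∂μ =
      c * ∫ z in stdTriangle, f (A + (z.1 • (B - A) + z.2 • (C - A))) := by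
  let l : ℝ × ℝ →ₗ[ℝ] E := (LinearMap.fst ℝ ℝ ℝ).smulRight (B - A) +
    (LinearMap.snd ℝ ℝ ℝ).smulRight (C - A)
  have hinj : Function.Injective l := by
    refine (injective_iff_map_eq_zero l).2 fun z hz => ?_
    have := LinearIndependent.pair_iff.1 h z.1 z.2 hz
    exact Prod.ext this.1 this.2
  let e : (ℝ × ℝ) ≃L[ℝ] E :=
    (l.linearEquivOfInjective hinj (by simp [hE])).toContinuousLinearEquiv
  let ψ : (ℝ × ℝ) ≃ₜ E := e.toHomeomorph.trans (Homeomorph.addLeft A)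
  let ν : Measure E := Measure.map e volume
  have hν : Measure.map ψ volume = ν := by
    have : (ψ : ℝ × ℝ → E) = (fun z => A + z) ∘ e := rfl
    rw [this, ← Measure.map_map (by fun_prop) e.continuous.measurable]
    exact map_add_left_eq_self ν A
  have hμ : μ = μ.addHaarScalarFactor ν • ν := Measure.isAddLeftInvariant_eq_smul μ ν
  refine ⟨μ.addHaarScalarFactor ν,
    NNReal.coe_ne_zero.2 (Measure.addHaarScalarFactor_pos_of_isAddHaarMeasure μ ν).ne',
    fun f => ?_⟩
  have hpre : ψ ⁻¹' (convexHull ℝ {A, B, C}) = stdTriangle := by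
    rw [convexHull_triple_eq_image]
    exact Set.preimage_image_eq _ ψ.injective
  conv_lhs => rw [hμ]
  have hf : ∫ P in convexHull ℝ {A, B, C}, f P ∂ν = ∫ z in stdTriangle, f (ψ z) := by
    rw [← hν, ψ.measurableEmbedding.setIntegral_map, hpre]
  rw [Measure.restrict_smul, integral_smul_nnreal_measure, hf]
  rfl

/-- The mean distance from `X` to the points of the segment from `A` to `B`. -/
noncomputable def meanDist {E : Type*} [NormedAddCommGroup E] [NormedSpace ℝ E] (A B X : E) : ℝ :=
  ∫ t in (0:ℝ)..1, ‖A + t • (B - A) - X‖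

theorem meanDist_comm {E : Type*} [NormedAddCommGroup E] [NormedSpace ℝ E] (A B X : E) :
    meanDist A B X = meanDist B A X := by
  have h := intervalIntegral.integral_comp_sub_left (a := 0) (b := 1)
    (fun t : ℝ => ‖B + t • (A - B) - X‖) 1
  rw [sub_self, sub_zero] at h
  rw [meanDist, meanDist, ← h]
  congr 1 with t
  congr 1
  module

theorem segInt_div_norm {A B : EuclideanSpace ℝ (Fin 2)} (h : B - A ≠ 0)
    (X : EuclideanSpace ℝ (Fin 2)) : segInt A B X / ‖B - A‖ = meanDist A B X := by
  rw [segInt, intervalIntegral.integral_mul_const, mul_div_cancel_right₀ _ (norm_ne_zero_iff.2 h),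
    meanDist]

theorem hasDerivAt_neg_norm_line {E : Type*} [NormedAddCommGroup E] [InnerProductSpace ℝ E]
    {p u X : E} {x : ℝ} (h : p + x • u ≠ X) :
    HasDerivAt (fun t : ℝ => -‖p + t • u - X‖) (inner ℝ (distGrad (p + x • u) X) u) x := by
  have h1 : HasDerivAt (fun t : ℝ => p + t • u) u x := by
    simpa using ((hasDerivAt_id x).smul_const u).const_add p
  have h2 := ((hasFDerivAt_norm_sub h.symm).comp_hasDerivAt x h1).neg
  convert! h2 using 1
  · ext t
    simp [norm_sub_rev]
  · rw [innerSL_apply_apply, ← inner_neg_left]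
    congr 1
    rw [distGrad, distGrad, norm_sub_rev, ← smul_neg, neg_sub]

theorem integral_inner_distGrad_line {E : Type*} [NormedAddCommGroup E] [InnerProductSpace ℝ E]
    [MeasurableSpace E] [BorelSpace E] [SecondCountableTopology E] {u : E} (hu : u ≠ 0)
    (p X : E) (a : ℝ) :
    ∫ x in (0:ℝ)..a, inner ℝ (distGrad (p + x • u) X) u = ‖p - X‖ - ‖p + a • u - X‖ := by
  have hinj : Function.Injective fun x : ℝ => p + x • u :=
    (add_right_injective p).comp (smul_left_injective ℝ hu)
  have hm : Measurable fun x : ℝ => inner ℝ (distGrad (p + x • u) X) u :=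
    ((measurable_distGrad X).comp (by fun_prop : Measurable fun x : ℝ => p + x • u)).inner_const
  rw [integral_eq_of_hasDerivAt_off_countable (fun t : ℝ => -‖p + t • u - X‖) _
    ((Set.countable_singleton X).preimage_of_injOn hinj.injOn) (by fun_prop)
    (fun x hx => hasDerivAt_neg_norm_line hx.2)]
  · simp
    ring
  · refine (intervalIntegrable_const (c := ‖u‖)).mono_fun hm.aestronglyMeasurable
      (.of_forall fun x => ?_)
    rw [norm_norm]
    exact (norm_inner_le_norm _ _).trans
      (mul_le_of_le_one_left (norm_nonneg _) (norm_distGrad_le _ _))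

theorem inner_setIntegral_distGrad_triangle {E : Type*} [NormedAddCommGroup E]
    [InnerProductSpace ℝ E] [FiniteDimensional ℝ E] [MeasurableSpace E] [BorelSpace E]
    (μ : Measure E) [μ.IsAddHaarMeasure] (hE : Module.finrank ℝ E = 2) {A B C : E}
    (h : LinearIndependent ℝ ![B - A, C - A]) (X : E) :
    inner ℝ (B - A) (∫ P in convexHull ℝ {A, B, C}, distGrad P X ∂μ) = 0 ↔
      meanDist A C X = meanDist B C X := by
  have : SecondCountableTopology E := by
    have := FiniteDimensional.proper ℝ E
    infer_instance
  have hu : B - A ≠ 0 := by simpa using h.ne_zero 0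
  have hcomp : IsCompact (convexHull ℝ {A, B, C}) := (Set.toFinite _).isCompact_convexHull ℝ
  obtain ⟨c, hc, hf⟩ := setIntegral_convexHull_triple μ hE h
  rw [← integral_inner (integrableOn_distGrad hcomp.measure_lt_top.ne X), hf,
    setIntegral_stdTriangle]
  · rw [mul_eq_zero, or_iff_right hc, ← sub_eq_zero (a := meanDist A C X), meanDist, meanDist,
      ← intervalIntegral.integral_sub (Continuous.intervalIntegrable (by fun_prop) _ _)
        (Continuous.intervalIntegrable (by fun_prop) _ _)]
    refine Eq.congr_left (intervalIntegral.integral_congr fun y _ => ?_)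
    have h1 := integral_inner_distGrad_line hu (A + y • (C - A)) X (1 - y)
    have h2 : A + y • (C - A) + (1 - y) • (B - A) = B + y • (C - B) := by module
    rw [h2] at h1
    simp only [← h1]
    congr 1 with x
    rw [real_inner_comm, add_assoc, add_comm (y • _)]
  · refine Measure.integrableOn_of_bounded isCompact_stdTriangle.measure_lt_top.ne
      (M := ‖B - A‖) ?_ (.of_forall fun z => ?_)
    · exact ((measurable_distGrad X).comp (by fun_prop : Measurable fun z : ℝ × ℝ =>
        A + (z.1 • (B - A) + z.2 • (C - A)))).const_inner.aestronglyMeasurable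
    · exact (norm_inner_le_norm _ _).trans
        (mul_le_of_le_one_right (norm_nonneg _) (norm_distGrad_le _ _))

theorem eq_zero_iff_inner_eq_zero_of_finrank_eq_two {E : Type*} [NormedAddCommGroup E]
    [InnerProductSpace ℝ E] (hE : Module.finrank ℝ E = 2) {u w : E}
    (h : LinearIndependent ℝ ![u, w]) (g : E) : g = 0 ↔ inner ℝ u g = 0 ∧ inner ℝ w g = 0 := by
  refine ⟨fun hg => by simp [hg], fun ⟨h1, h2⟩ => ?_⟩
  let b := basisOfLinearIndependentOfCardEqFinrank h (by simp [hE])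
  have h0 : (innerSL ℝ g : E →ₗ[ℝ] ℝ) = 0 := b.ext fun i => by
    fin_cases i <;> simp [b, real_inner_comm, h1, h2]
  simpa using DFunLike.congr_fun h0 g

theorem stmt_0 (P1 P2 P3 m : EuclideanSpace ℝ (Fin 2))
    (h : AffineIndependent ℝ ![P1, P2, P3]) :
    (∀ X, sigmaSet (convexHull ℝ {P1, P2, P3}) m ≤ sigmaSet (convexHull ℝ {P1, P2, P3}) X) ↔
      (segInt P1 P2 m / ‖P2 - P1‖) • (P2 - P1) +
        (segInt P2 P3 m / ‖P3 - P2‖) • (P3 - P2) +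
        (segInt P3 P1 m / ‖P1 - P3‖) • (P1 - P3) = 0 := by
  have hE : Module.finrank ℝ (EuclideanSpace ℝ (Fin 2)) = 2 := by simp
  have hli : LinearIndependent ℝ ![P2 - P1, P3 - P1] := by
    have h' := (affineIndependent_iff_linearIndependent_vsub ℝ _ 0).1 h
    have hinj : Function.Injective
        (![⟨1, by simp⟩, ⟨2, by simp⟩] : Fin 2 → {i : Fin 3 // i ≠ 0}) := by
      decide
    convert! h'.comp _ hinj using 1
    ext i : 1
    fin_cases i <;> rfl
  have hli' : LinearIndependent ℝ ![P3 - P1, P2 - P1] := LinearIndependent.pair_symm_iff.1 hli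
  have h12 : P2 - P1 ≠ 0 := by simpa using hli.ne_zero 0
  have h31 : P1 - P3 ≠ 0 := by simpa [sub_eq_zero, eq_comm] using hli.ne_zero 1
  have h23 : P3 - P2 ≠ 0 := by
    intro h0
    have := LinearIndependent.pair_iff.1 hli 1 (-1) (by rw [← neg_eq_zero, ← h0]; module)
    exact one_ne_zero this.1
  have hcomp : IsCompact (convexHull ℝ {P1, P2, P3}) := (Set.toFinite _).isCompact_convexHull ℝ
  have hswap : ({P1, P3, P2} : Set (EuclideanSpace ℝ (Fin 2))) = {P1, P2, P3} := by
    rw [Set.pair_comm]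
  have hw := inner_setIntegral_distGrad_triangle volume hE hli' m
  rw [hswap] at hw
  simp only [sigmaSet]
  rw [setIntegral_norm_sub_minimal_iff hcomp m,
    eq_zero_iff_inner_eq_zero_of_finrank_eq_two hE hli,
    inner_setIntegral_distGrad_triangle volume hE hli m, hw, segInt_div_norm h12,
    segInt_div_norm h23, segInt_div_norm h31, meanDist_comm P3 P2, meanDist_comm P3 P1]
  have hsum : meanDist P1 P2 m • (P2 - P1) + meanDist P2 P3 m • (P3 - P2) +
      meanDist P1 P3 m • (P1 - P3) = (meanDist P1 P2 m - meanDist P2 P3 m) • (P2 - P1) +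
        (meanDist P2 P3 m - meanDist P1 P3 m) • (P3 - P1) := by module
  rw [hsum]
  constructor
  · rintro ⟨h1, h2⟩
    rw [h1, h2]
    simp
  · intro h0
    have := LinearIndependent.pair_iff.1 hli _ _ h0
    exact ⟨by linarith, by linarith⟩
end

section
/- Let α, β be real numbers with 0 < β ≤ α ≤ 2β, let e ∈ ℝ² be a unit vector, and consider the collinear points O = 0, A = α·e, B = β·e (the vertices of the flattened triangle with sides α, β and α−β). Then the point m = √(αβ/2)·e satisfies the equal-mean-distance relations of the geometric median: Σ_{OA}(m)/α = Σ_{AB}(m)/(α−β) = Σ_{OB}(m)/β (when α = β the middle term, whose segment is degenerate, is omitted and the outer equality Σ_{OA}(m)/α = Σ_{OB}(m)/β holds). In particular m lies at distance √(αβ/2) from the common vertex O of the two sides of lengths α and β. -/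
open MeasureTheory

/-- On the line spanned by a unit vector, the segment integral is a one-dimensional integral. -/
theorem segInt_smul (a b s : ℝ) (e : EuclideanSpace ℝ (Fin 2)) (he : ‖e‖ = 1) :
    segInt (a • e) (b • e) (s • e) = (∫ t in (0:ℝ)..1, |a + t * (b - a) - s|) * |b - a| := by
  unfold segInt
  rw [← intervalIntegral.integral_mul_const]
  congr 1
  ext t
  have h : a • e + t • (b • e - a • e) - s • e = (a + t * (b - a) - s) • e := by module
  rw [h, ← sub_smul, norm_smul, norm_smul, he, mul_one, mul_one, Real.norm_eq_abs,
    Real.norm_eq_abs]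

theorem integral_affine (u v p q : ℝ) :
    ∫ t in p..q, (u + t * v) = u * (q - p) + v * (q ^ 2 - p ^ 2) / 2 := by
  rw [intervalIntegral.integral_add (by simp) (by simp), intervalIntegral.integral_const,
    intervalIntegral.integral_mul_const, integral_id, smul_eq_mul]
  ring

/-- The mean distance from an interior point `s` to the interval `[0, a]`. -/
theorem integral_abs_mul_sub {a s : ℝ} (ha : 0 < a) (hs : 0 ≤ s) (hsa : s ≤ a) :
    ∫ t in (0:ℝ)..1, |t * a - s| = s ^ 2 / a + a / 2 - s := by
  have hint (p q : ℝ) : IntervalIntegrable (fun t ↦ |t * a - s|) volume p q :=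
    Continuous.intervalIntegrable (by fun_prop) p q
  have h0 : 0 ≤ s / a := by positivity
  have h1 : s / a ≤ 1 := (div_le_one ha).2 hsa
  have hleft : ∫ t in (0:ℝ)..(s / a), |t * a - s| = ∫ t in (0:ℝ)..(s / a), (s + t * (-a)) := by
    refine intervalIntegral.integral_congr fun t ht ↦ ?_
    rw [Set.uIcc_of_le h0] at ht
    have : t * a ≤ s := (le_div_iff₀ ha).1 ht.2
    rw [abs_of_nonpos (by linarith)]
    ring
  have hright : ∫ t in (s / a)..1, |t * a - s| = ∫ t in (s / a)..1, (-s + t * a) := by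
    refine intervalIntegral.integral_congr fun t ht ↦ ?_
    rw [Set.uIcc_of_le h1] at ht
    have : s ≤ t * a := (div_le_iff₀ ha).1 ht.1
    rw [abs_of_nonneg (by linarith)]
    ring
  rw [← intervalIntegral.integral_add_adjacent_intervals (hint 0 (s / a)) (hint (s / a) 1),
    hleft, hright, integral_affine, integral_affine]
  field_simp
  ring

/-- The mean distance from `s` to the interval `[b, a]` when `s` does not exceed its endpoints. -/
theorem integral_abs_segment_sub {a b s : ℝ} (hsa : s ≤ a) (hsb : s ≤ b) :
    ∫ t in (0:ℝ)..1, |a + t * (b - a) - s| = (a + b) / 2 - s := by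
  have h : ∫ t in (0:ℝ)..1, |a + t * (b - a) - s| =
      ∫ t in (0:ℝ)..1, ((a - s) + t * (b - a)) := by
    refine intervalIntegral.integral_congr fun t ht ↦ ?_
    rw [Set.uIcc_of_le zero_le_one] at ht
    rw [abs_of_nonneg (by nlinarith [ht.1, ht.2])]
    ring
  rw [h, integral_affine]
  ring

/-- The mean distance from `s • e` to the segment from the origin to `a • e`. -/
theorem segInt_zero_smul_div {a s : ℝ} (ha : 0 < a) (hs : 0 ≤ s) (hsa : s ≤ a)
    (e : EuclideanSpace ℝ (Fin 2)) (he : ‖e‖ = 1) :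
    segInt 0 (a • e) (s • e) / a = s ^ 2 / a + a / 2 - s := by
  have h := segInt_smul 0 a s e he
  simp only [zero_smul, zero_add, sub_zero] at h
  rw [h, abs_of_pos ha, mul_div_cancel_right₀ _ ha.ne', integral_abs_mul_sub ha hs hsa]

theorem stmt_7 (α β : ℝ) (hβ : 0 < β) (hβα : β ≤ α) (hα : α ≤ 2 * β)
    (e : EuclideanSpace ℝ (Fin 2)) (he : ‖e‖ = 1) :
    -- vertices of the flattened triangle with sides `α`, `β`, `α − β`:
    -- `O = 0`, `A = α • e`, `B = β • e`; the candidate median `m = √(αβ/2) • e`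
    segInt 0 (α • e) (Real.sqrt (α * β / 2) • e) / α =
        segInt 0 (β • e) (Real.sqrt (α * β / 2) • e) / β ∧
      (α ≠ β →
        segInt (α • e) (β • e) (Real.sqrt (α * β / 2) • e) / (α - β) =
          segInt 0 (α • e) (Real.sqrt (α * β / 2) • e) / α) ∧
      ‖Real.sqrt (α * β / 2) • e - 0‖ = Real.sqrt (α * β / 2) := by
  have hα0 : 0 < α := hβ.trans_le hβα
  have hs : 0 ≤ Real.sqrt (α * β / 2) := Real.sqrt_nonneg _
  have hsq : Real.sqrt (α * β / 2) ^ 2 = α * β / 2 := Real.sq_sqrt (by positivity)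
  have hsβ : Real.sqrt (α * β / 2) ≤ β := Real.sqrt_le_iff.2 ⟨hβ.le, by nlinarith⟩
  have hsα := hsβ.trans hβα
  have hA := segInt_zero_smul_div hα0 hs hsα e he
  have hB := segInt_zero_smul_div hβ hs hsβ e he
  rw [hsq] at hA hB
  refine ⟨?_, fun hne ↦ ?_, ?_⟩
  · rw [hA, hB]
    field_simp
    ring
  · have hpos : 0 < α - β := sub_pos.2 (lt_of_le_of_ne hβα hne.symm)
    rw [segInt_smul _ _ _ e he, abs_sub_comm, abs_of_pos hpos,
      mul_div_cancel_right₀ _ hpos.ne', integral_abs_segment_sub hsα hsβ, hA]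
    field_simp
    ring
  · rw [sub_zero, norm_smul, he, mul_one, Real.norm_of_nonneg hs]
end

section
/- Let P1, P2, P3 be affinely independent points of ℝ² and let Δ = conv{P1,P2,P3}. Then the function Σ_Δ : ℝ² → ℝ, Σ_Δ(X) = ∫_{P∈Δ} ‖P−X‖ dP, is strictly convex, and it attains its minimum over ℝ² at exactly one point; i.e. the geometric median of a nondegenerate triangular region exists and is unique. -/
open MeasureTheory

theorem integrableOn_norm_sub_s8 {Ω : Set (EuclideanSpace ℝ (Fin 2))} (hΩ : IsCompact Ω)
    (X : EuclideanSpace ℝ (Fin 2)) : IntegrableOn (fun P => ‖P - X‖) Ω :=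
  (by fun_prop : Continuous fun P => ‖P - X‖).continuousOn.integrableOn_compact hΩ

theorem mem_affineSpan_pair_of_sameRay_sub {V : Type*} [AddCommGroup V] [Module ℝ V]
    {x y p : V} (hxy : x ≠ y) (h : SameRay ℝ (p - x) (p - y)) : p ∈ line[ℝ, x, y] := by
  rcases h with h | h | ⟨r, s, hr, hs, h⟩
  · rw [sub_eq_zero.1 h]; exact left_mem_affineSpan_pair ℝ x y
  · rw [sub_eq_zero.1 h]; exact right_mem_affineSpan_pair ℝ x y
  · have hrs : r - s ≠ 0 := by
      intro hrs
      rw [sub_eq_zero.1 hrs] at h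
      exact hxy (sub_right_injective (smul_right_injective V hs.ne' h))
    have hp : p = AffineMap.lineMap x y (-s / (r - s)) := by
      apply smul_right_injective V hrs
      simp only [AffineMap.lineMap_apply_module', smul_add, smul_smul, mul_div_cancel₀ _ hrs]
      have h' : r • p - r • x = s • p - s • y := by simpa only [smul_sub] using h
      have : r • p = s • p - s • y + r • x := by rw [← h']; abel
      rw [sub_smul, this]
      module
    rw [hp]
    exact AffineMap.lineMap_mem_affineSpan_pair _ _ _

theorem volume_affineSpan_pair (x y : EuclideanSpace ℝ (Fin 2)) :
    volume (line[ℝ, x, y] : Set (EuclideanSpace ℝ (Fin 2))) = 0 := by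
  refine Measure.addHaar_affineSubspace volume _ fun htop => ?_
  have h := collinear_iff_finrank_le_one.1 (collinear_pair ℝ x y)
  rw [← direction_affineSpan, htop, AffineSubspace.direction_top, finrank_top,
    finrank_euclideanSpace_fin] at h
  omega

theorem strictConvexOn_sigmaSet {Ω : Set (EuclideanSpace ℝ (Fin 2))} (hΩ : IsCompact Ω)
    (hpos : volume Ω ≠ 0) : StrictConvexOn ℝ Set.univ (sigmaSet Ω) := by
  refine ⟨convex_univ, fun x _ y _ hxy a b ha hb hab => ?_⟩
  have hx := (integrableOn_norm_sub_s8 hΩ x).const_mul a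
  have hy := (integrableOn_norm_sub_s8 hΩ y).const_mul b
  have hz := integrableOn_norm_sub_s8 hΩ (a • x + b • y)
  have hsplit (P : EuclideanSpace ℝ (Fin 2)) :
      P - (a • x + b • y) = a • (P - x) + b • (P - y) := by
    obtain rfl : b = 1 - a := by linarith
    module
  have hle (P : EuclideanSpace ℝ (Fin 2)) :
      ‖P - (a • x + b • y)‖ ≤ a * ‖P - x‖ + b * ‖P - y‖ := by
    rw [hsplit]
    exact (norm_add_le _ _).trans_eq (by simp [norm_smul, abs_of_pos ha, abs_of_pos hb])
  have hmono : sigmaSet Ω (a • x + b • y) ≤ a • sigmaSet Ω x + b • sigmaSet Ω y := by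
    simp only [sigmaSet, smul_eq_mul, ← integral_const_mul]
    rw [← integral_add hx hy]
    exact integral_mono hz (hx.add hy) hle
  refine lt_of_le_of_ne hmono fun heq => hpos ?_
  simp only [sigmaSet, smul_eq_mul, ← integral_const_mul] at heq
  rw [← integral_add hx hy] at heq
  replace heq := (integral_eq_iff_of_ae_le hz (hx.add hy) (Filter.Eventually.of_forall hle)).1 heq
  have hline : ∀ᵐ P ∂volume.restrict Ω, P ∈ line[ℝ, x, y] := by
    filter_upwards [heq] with P hP
    refine mem_affineSpan_pair_of_sameRay_sub hxy ?_
    have hray : SameRay ℝ (a • (P - x)) (b • (P - y)) := by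
      rw [sameRay_iff_norm_add, ← hsplit, hP]
      simp [norm_smul, abs_of_pos ha, abs_of_pos hb]
    simpa only [inv_smul_smul₀ ha.ne', inv_smul_smul₀ hb.ne'] using
      (hray.pos_smul_left (inv_pos.2 ha)).pos_smul_right (inv_pos.2 hb)
  rw [ae_restrict_iff' hΩ.measurableSet] at hline
  have hnot := measure_eq_zero_iff_ae_notMem.1 (volume_affineSpan_pair x y)
  rw [measure_eq_zero_iff_ae_notMem]
  filter_upwards [hline, hnot] with P h₁ h₂ h₃ using h₂ (h₁ h₃)

theorem tendsto_sigmaSet_cocompact {Ω : Set (EuclideanSpace ℝ (Fin 2))} (hΩ : IsCompact Ω)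
    (hpos : volume Ω ≠ 0) :
    Filter.Tendsto (sigmaSet Ω) (Filter.cocompact _) Filter.atTop := by
  have hreal : 0 < volume.real Ω := ENNReal.toReal_pos hpos hΩ.measure_lt_top.ne
  have hbound (X : EuclideanSpace ℝ (Fin 2)) :
      volume.real Ω * ‖X‖ + -sigmaSet Ω 0 ≤ sigmaSet Ω X := by
    have hconst : IntegrableOn (fun _ : EuclideanSpace ℝ (Fin 2) => ‖X‖) Ω :=
      integrableOn_const hΩ.measure_lt_top.ne
    have h0 := integrableOn_norm_sub_s8 hΩ 0
    have h : ∫ P in Ω, (‖X‖ - ‖P - 0‖) ≤ ∫ P in Ω, ‖P - X‖ := by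
      refine integral_mono (hconst.sub h0) (integrableOn_norm_sub_s8 hΩ X) fun P => ?_
      simpa [norm_sub_rev] using norm_sub_norm_le X P
    rwa [integral_sub hconst h0, setIntegral_const, smul_eq_mul, sub_eq_add_neg] at h
  exact Filter.tendsto_atTop_mono hbound (Filter.tendsto_atTop_add_const_right _ _
    (Filter.Tendsto.const_mul_atTop hreal tendsto_norm_cocompact_atTop))

theorem existsUnique_forall_sigmaSet_le {Ω : Set (EuclideanSpace ℝ (Fin 2))} (hΩ : IsCompact Ω)
    (hpos : volume Ω ≠ 0) : ∃! m, ∀ X, sigmaSet Ω m ≤ sigmaSet Ω X := by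
  have hconv := strictConvexOn_sigmaSet hΩ hpos
  have hcont : Continuous (sigmaSet Ω) :=
    continuousOn_univ.1 (hconv.convexOn.continuousOn isOpen_univ)
  obtain ⟨m, hm⟩ := hcont.exists_forall_le (tendsto_sigmaSet_cocompact hΩ hpos)
  exact ⟨m, hm, fun n hn => hconv.eq_of_isMinOn (fun X _ => hn X) (fun X _ => hm X)
    (Set.mem_univ _) (Set.mem_univ _)⟩

theorem volume_convexHull_triple_ne_zero {P1 P2 P3 : EuclideanSpace ℝ (Fin 2)}
    (h : AffineIndependent ℝ ![P1, P2, P3]) :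
    volume (convexHull ℝ {P1, P2, P3}) ≠ 0 := by
  have hspan : affineSpan ℝ (Set.range ![P1, P2, P3]) = ⊤ :=
    h.affineSpan_eq_top_iff_card_eq_finrank_add_one.2 (by simp)
  have hrange : Set.range ![P1, P2, P3] = {P1, P2, P3} := by
    simp only [Matrix.range_cons, Matrix.range_empty, Set.union_empty, Set.singleton_union]
  rw [hrange] at hspan
  exact (Measure.measure_pos_of_nonempty_interior _
    (interior_convexHull_nonempty_iff_affineSpan_eq_top.2 hspan)).ne'

theorem stmt_8 (P1 P2 P3 : EuclideanSpace ℝ (Fin 2))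
    (h : AffineIndependent ℝ ![P1, P2, P3]) :
    StrictConvexOn ℝ Set.univ (sigmaSet (convexHull ℝ {P1, P2, P3})) ∧
      ∃! m : EuclideanSpace ℝ (Fin 2),
        ∀ X, sigmaSet (convexHull ℝ {P1, P2, P3}) m ≤ sigmaSet (convexHull ℝ {P1, P2, P3}) X := by
  have hcompact : IsCompact (convexHull ℝ ({P1, P2, P3} : Set (EuclideanSpace ℝ (Fin 2)))) :=
    (Set.toFinite _).isCompact_convexHull ℝ
  have hpos := volume_convexHull_triple_ne_zero h
  exact ⟨strictConvexOn_sigmaSet hcompact hpos, existsUnique_forall_sigmaSet_le hcompact hpos⟩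
end

section
/- Let A, B ∈ ℝ² with A ≠ B, let v ∈ ℝ² be a unit vector not parallel to B−A, and let X ∈ ℝ². For δ > 0 let π(δ) be the closed parallelogram with vertices A, B, B−δ·v, A−δ·v, and let |π(δ)| denote its area. Then the average distance from X over the parallelogram converges to the average distance from X over the segment AB as the parallelogram collapses: lim_{δ→0⁺} (1/|π(δ)|)·∫_{P∈π(δ)} ‖P−X‖ dP = (1/‖B−A‖)·∫_{t∈[0,1]} ‖A + t·(B−A) − X‖·‖B−A‖ dt. -/
open MeasureTheory

/-- The planar cross product `u ∧ w = u₁ w₂ − u₂ w₁`. -/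
noncomputable def cross2 (u w : EuclideanSpace ℝ (Fin 2)) : ℝ :=
  u 0 * w 1 - u 1 * w 0

/-- The parametrization `x ↦ x₀ • u - x₁ • w` of the parallelogram spanned by `u` and `-w`. -/
noncomputable def spanMap (u w : EuclideanSpace ℝ (Fin 2)) :
    EuclideanSpace ℝ (Fin 2) →L[ℝ] EuclideanSpace ℝ (Fin 2) :=
  (EuclideanSpace.proj 0 : EuclideanSpace ℝ (Fin 2) →L[ℝ] ℝ).smulRight u -
    (EuclideanSpace.proj 1 : EuclideanSpace ℝ (Fin 2) →L[ℝ] ℝ).smulRight w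

theorem spanMap_apply (u w x : EuclideanSpace ℝ (Fin 2)) :
    spanMap u w x = x 0 • u - x 1 • w := by
  simp [spanMap]

theorem spanMap_det (u w : EuclideanSpace ℝ (Fin 2)) : (spanMap u w).det = cross2 w u := by
  rw [ContinuousLinearMap.det,
    ← LinearMap.det_toMatrix (EuclideanSpace.basisFun (Fin 2) ℝ).toBasis, Matrix.det_fin_two]
  simp [LinearMap.toMatrix_apply, spanMap_apply, cross2]
  ring

/-- The closed unit square in the Euclidean plane. -/
def unitSquare : Set (EuclideanSpace ℝ (Fin 2)) :=
  {x | x 0 ∈ Set.Icc (0 : ℝ) 1 ∧ x 1 ∈ Set.Icc (0 : ℝ) 1}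

theorem convex_unitSquare : Convex ℝ unitSquare :=
  ((convex_Icc (0 : ℝ) 1).linear_preimage
    (EuclideanSpace.proj 0 : EuclideanSpace ℝ (Fin 2) →L[ℝ] ℝ).toLinearMap).inter
  ((convex_Icc (0 : ℝ) 1).linear_preimage
    (EuclideanSpace.proj 1 : EuclideanSpace ℝ (Fin 2) →L[ℝ] ℝ).toLinearMap)

theorem convexHull_parallelogram_eq_image (A u w : EuclideanSpace ℝ (Fin 2)) :
    convexHull ℝ {A, A + u, A + u - w, A - w} = (fun x => A + spanMap u w x) '' unitSquare := by
  apply Set.Subset.antisymm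
  · refine convexHull_min ?_ ?_
    · rintro P (rfl | rfl | rfl | rfl)
      · exact ⟨!₂[0, 0], by simp [unitSquare], by simp [spanMap_apply]⟩
      · exact ⟨!₂[1, 0], by simp [unitSquare], by simp [spanMap_apply]⟩
      · exact ⟨!₂[1, 1], by simp [unitSquare], by simp [spanMap_apply, add_sub_assoc]⟩
      · exact ⟨!₂[0, 1], by simp [unitSquare], by simp [spanMap_apply, sub_eq_add_neg]⟩
    · have h := (convex_unitSquare.linear_image (spanMap u w).toLinearMap).translate A
      rw [Set.image_image] at h
      exact h
  · rintro _ ⟨x, ⟨⟨h0, h0'⟩, ⟨h1, h1'⟩⟩, rfl⟩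
    have hc := convex_convexHull ℝ ({A, A + u, A + u - w, A - w} : Set (EuclideanSpace ℝ (Fin 2)))
    have hs := subset_convexHull ℝ ({A, A + u, A + u - w, A - w} : Set (EuclideanSpace ℝ (Fin 2)))
    have top : (1 - x 0) • A + x 0 • (A + u) ∈
        convexHull ℝ ({A, A + u, A + u - w, A - w} : Set (EuclideanSpace ℝ (Fin 2))) :=
      hc (hs (by simp)) (hs (by simp)) (by linarith) h0 (by ring)
    have bottom : (1 - x 0) • (A - w) + x 0 • (A + u - w) ∈
        convexHull ℝ ({A, A + u, A + u - w, A - w} : Set (EuclideanSpace ℝ (Fin 2))) :=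
      hc (hs (by simp)) (hs (by simp)) (by linarith) h0 (by ring)
    convert hc top bottom (sub_nonneg.2 h1') h1 (by ring) using 1
    simp only [spanMap_apply]
    module

theorem cross2_ne_zero {u w : EuclideanSpace ℝ (Fin 2)} (h : LinearIndependent ℝ ![w, u]) :
    cross2 w u ≠ 0 := by
  intro h0
  rw [LinearIndependent.pair_iff] at h
  unfold cross2 at h0
  have h1 := h (u 1) (-w 1) (by
    ext i; fin_cases i
    · simp; linarith
    · simp; ring)
  have h2 := h (u 0) (-w 0) (by
    ext i; fin_cases i
    · simp; ring
    · simp; linarith)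
  have h3 := h 1 0 (by
    ext i; fin_cases i
    · simpa using h2.2
    · simpa using h1.2)
  exact one_ne_zero h3.1

theorem spanMap_injective {u w : EuclideanSpace ℝ (Fin 2)} (h : cross2 w u ≠ 0) :
    Function.Injective (spanMap u w) := by
  have hd : (spanMap u w).toLinearMap.det ≠ 0 := by
    rw [← ContinuousLinearMap.det, spanMap_det]
    exact h
  exact (LinearMap.equivOfDetNeZero (spanMap u w).toLinearMap hd).injective

theorem isCompact_unitSquare : IsCompact unitSquare := by
  have h := (isCompact_univ_pi (fun _ : Fin 2 => isCompact_Icc (a := (0 : ℝ)) (b := 1))).image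
    (PiLp.continuous_toLp 2 (fun _ : Fin 2 => ℝ))
  convert h using 1
  ext x
  constructor
  · intro hx
    exact ⟨x.ofLp, fun i _ => by fin_cases i; exacts [hx.1, hx.2], rfl⟩
  · rintro ⟨y, hy, rfl⟩
    exact ⟨hy 0 trivial, hy 1 trivial⟩

theorem setIntegral_parallelogram (A u w : EuclideanSpace ℝ (Fin 2)) (h : cross2 w u ≠ 0)
    (g : EuclideanSpace ℝ (Fin 2) → ℝ) :
    ∫ P in convexHull ℝ {A, A + u, A + u - w, A - w}, g P =
      |cross2 w u| * ∫ x in unitSquare, g (A + spanMap u w x) := by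
  rw [convexHull_parallelogram_eq_image,
    integral_image_eq_integral_abs_det_fderiv_smul volume isCompact_unitSquare.measurableSet
      (f' := fun _ => spanMap u w)
      (fun x _ => ((spanMap u w).hasFDerivAt.const_add A).hasFDerivWithinAt)
      (fun x _ y _ hxy => spanMap_injective h (add_left_cancel hxy)),
    ← integral_const_mul]
  simp only [spanMap_det, smul_eq_mul]

theorem setIntegral_unitSquare_fst (g : ℝ → ℝ) :
    ∫ x in unitSquare, g (x 0) = ∫ t in (0 : ℝ)..1, g t := by
  have hm := (volume_preserving_finTwoArrow ℝ).comp (PiLp.volume_preserving_ofLp (Fin 2))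
  have he : MeasurableEmbedding
      ((MeasurableEquiv.finTwoArrow : (Fin 2 → ℝ) ≃ᵐ ℝ × ℝ) ∘
        (WithLp.ofLp : EuclideanSpace ℝ (Fin 2) → Fin 2 → ℝ)) :=
    MeasurableEquiv.finTwoArrow.measurableEmbedding.comp
      (MeasurableEquiv.toLp 2 (Fin 2 → ℝ)).symm.measurableEmbedding
  have key := hm.setIntegral_preimage_emb he (fun p : ℝ × ℝ => g p.1 * 1)
    (Set.Icc 0 1 ×ˢ Set.Icc 0 1)
  rw [Measure.volume_eq_prod, setIntegral_prod_mul g (fun _ => (1 : ℝ))] at key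
  rw [intervalIntegral.integral_of_le zero_le_one, ← integral_Icc_eq_integral_Ioc]
  simp only [mul_one, integral_const, smul_eq_mul] at key
  simpa [Set.preimage, unitSquare, MeasurableEquiv.finTwoArrow_apply, -Set.Icc_prod_Icc] using key

theorem continuous_setIntegral_unitSquare (A u v X : EuclideanSpace ℝ (Fin 2)) :
    Continuous fun δ : ℝ => ∫ x in unitSquare, ‖A + spanMap u (δ • v) x - X‖ := by
  apply continuous_parametric_integral_of_continuous _ isCompact_unitSquare
  simp only [Function.uncurry_def, spanMap_apply]
  fun_prop

theorem stmt_9 (A B v X : EuclideanSpace ℝ (Fin 2)) (hAB : A ≠ B) (hv : ‖v‖ = 1)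
    (hpar : LinearIndependent ℝ ![v, B - A]) :
    Filter.Tendsto
      (fun δ : ℝ =>
        (1 / (δ * |cross2 v (B - A)|)) *
          ∫ P in convexHull ℝ {A, B, B - δ • v, A - δ • v}, ‖P - X‖)
      (nhdsWithin 0 (Set.Ioi 0))
      (nhds ((1 / ‖B - A‖) * segInt A B X)) := by
  have hc := cross2_ne_zero hpar
  have hn : ‖B - A‖ ≠ 0 := norm_ne_zero_iff.2 (sub_ne_zero.2 hAB.symm)
  have hlim := (continuous_setIntegral_unitSquare A (B - A) v X).tendsto 0
  have hval : ∫ x in unitSquare, ‖A + spanMap (B - A) ((0 : ℝ) • v) x - X‖ =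
      (1 / ‖B - A‖) * segInt A B X := by
    simp only [spanMap_apply, zero_smul, smul_zero, sub_zero]
    rw [setIntegral_unitSquare_fst (fun t => ‖A + t • (B - A) - X‖), segInt,
      intervalIntegral.integral_mul_const]
    field_simp
  rw [hval] at hlim
  refine (hlim.mono_left nhdsWithin_le_nhds).congr' ?_
  filter_upwards [self_mem_nhdsWithin] with δ (hδ : 0 < δ)
  have hcr : cross2 (δ • v) (B - A) = δ * cross2 v (B - A) := by
    simp [cross2]; ring
  have h := setIntegral_parallelogram A (B - A) (δ • v)
    (by rw [hcr]; exact mul_ne_zero hδ.ne' hc) (fun P => ‖P - X‖)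
  rw [add_sub_cancel] at h
  rw [h, hcr, abs_mul, abs_of_pos hδ]
  have := abs_ne_zero.2 hc
  field_simp
end

section
/- Let n ≥ 1, let a, b ∈ ℝⁿ with a_i < b_i for all i, let Ω = Π_i [a_i, b_i] be the closed rectangular box, and let f : ℝⁿ → ℝ be continuous. Define Σ^f_Ω(X) = ∫_{P∈Ω} f(P−X) dP. Then Σ^f_Ω is differentiable at every X ∈ ℝⁿ, and X is a critical point of Σ^f_Ω if and only if the boundary integral of f(P−X) times the outward unit normal vanishes, i.e. for every coordinate i: ∫_{F_i⁺} f(P−X) dP = ∫_{F_i⁻} f(P−X) dP, where F_i⁺ and F_i⁻ are the faces {P ∈ Ω : P_i = b_i} and {P ∈ Ω : P_i = a_i} with their (n−1)-dimensional Lebesgue measures. -/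
open MeasureTheory

namespace BoxFaceIntegral

/-- A function on Euclidean space all of whose partial derivatives exist everywhere and are
continuous is Fréchet differentiable, with the expected derivative. -/
theorem hasFDerivAt_of_continuous_partials {ι : Type*} [Fintype ι] [DecidableEq ι]
    {g : EuclideanSpace ℝ ι → ℝ} {L : ι → EuclideanSpace ℝ ι → ℝ}
    (hL : ∀ i, Continuous (L i))
    (hg : ∀ i Y t, HasDerivAt (fun s : ℝ => g (Y + s • EuclideanSpace.single i 1))
      (L i (Y + t • EuclideanSpace.single i 1)) t)
    (X : EuclideanSpace ℝ ι) :
    HasFDerivAt g (∑ i, L i X • (EuclideanSpace.proj i : EuclideanSpace ℝ ι →L[ℝ] ℝ)) X := by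
  have key : ∀ S : Finset ι,
      (fun h : EuclideanSpace ℝ ι =>
        g (X + ∑ j ∈ S, h j • EuclideanSpace.single j 1) - g X - ∑ j ∈ S, L j X * h j)
        =o[nhds 0] fun h => h := by
    intro S
    induction S using Finset.induction_on with
    | empty => simp
    | insert i S hi ih =>
      have step : (fun h : EuclideanSpace ℝ ι =>
          g (X + ∑ j ∈ S, h j • EuclideanSpace.single j 1 + h i • EuclideanSpace.single i 1)
            - g (X + ∑ j ∈ S, h j • EuclideanSpace.single j 1) - L i X * h i)
          =o[nhds 0] fun h => h := by
        rw [Asymptotics.isLittleO_iff]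
        intro ε hε
        obtain ⟨δ, hδ, hball⟩ := Metric.continuousAt_iff.1 ((hL i).continuousAt (x := X)) ε hε
        have hM : Continuous fun h : EuclideanSpace ℝ ι =>
            ‖∑ j ∈ S, h j • (EuclideanSpace.single j 1 : EuclideanSpace ℝ ι)‖ + ‖h i‖ := by
          fun_prop
        have hev := (hM.tendsto 0).eventually_lt_const (u := δ) (by simpa using hδ)
        filter_upwards [hev] with h hh
        set Y := X + ∑ j ∈ S, h j • (EuclideanSpace.single j 1 : EuclideanSpace ℝ ι) with hY
        have hd : ∀ t ∈ Set.uIcc 0 (h i), HasDerivWithinAt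
            (fun s : ℝ => g (Y + s • EuclideanSpace.single i 1) - L i X * s)
            (L i (Y + t • EuclideanSpace.single i 1) - L i X) (Set.uIcc 0 (h i)) t := by
          intro t _
          exact (((hg i Y t).sub ((hasDerivAt_id t).const_mul (L i X))).congr_deriv
            (by rw [mul_one])).hasDerivWithinAt
        have hb : ∀ t ∈ Set.uIcc 0 (h i),
            ‖L i (Y + t • EuclideanSpace.single i 1) - L i X‖ ≤ ε := by
          intro t ht
          have ht' : ‖t‖ ≤ ‖h i‖ := by
            simpa using Set.abs_sub_left_of_mem_uIcc ht
          rw [← dist_eq_norm]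
          refine (hball ?_).le
          rw [dist_eq_norm, hY]
          have : X + ∑ j ∈ S, h j • (EuclideanSpace.single j 1 : EuclideanSpace ℝ ι)
              + t • EuclideanSpace.single i 1 - X
              = ∑ j ∈ S, h j • (EuclideanSpace.single j 1 : EuclideanSpace ℝ ι)
                + t • EuclideanSpace.single i 1 := by abel
          rw [this]
          refine (norm_add_le _ _).trans_lt (lt_of_le_of_lt ?_ hh)
          gcongr
          simpa [norm_smul] using ht'
        have hmv := (convex_uIcc 0 (h i)).norm_image_sub_le_of_norm_hasDerivWithin_le hd hb
          Set.left_mem_uIcc Set.right_mem_uIcc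
        have hle : ‖h i‖ ≤ ‖h‖ := PiLp.norm_apply_le h i
        calc _ = ‖g (Y + h i • EuclideanSpace.single i 1) - L i X * h i
                - (g (Y + (0 : ℝ) • EuclideanSpace.single i 1) - L i X * 0)‖ := by
              congr 1; simp; ring
          _ ≤ ε * ‖h i - 0‖ := hmv
          _ ≤ ε * ‖h‖ := by rw [sub_zero]; gcongr
      refine (step.add ih).congr_left fun h => ?_
      rw [Finset.sum_insert hi, Finset.sum_insert hi,
        add_comm (h i • (EuclideanSpace.single i 1 : EuclideanSpace ℝ ι)), ← add_assoc]
      ring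
  rw [hasFDerivAt_iff_isLittleO_nhds_zero]
  refine (key Finset.univ).congr_left fun h => ?_
  have hsum : ∑ j, h j • (EuclideanSpace.single j 1 : EuclideanSpace ℝ ι) = h := by
    simpa using (EuclideanSpace.basisFun ι ℝ).sum_repr h
  rw [hsum]
  simp

/-- The closed box with corners `a` and `b`. -/
def box {ι : Type*} (a b : EuclideanSpace ℝ ι) : Set (EuclideanSpace ℝ ι) :=
  {P | ∀ i, a i ≤ P i ∧ P i ≤ b i}

theorem isCompact_box {ι : Type*} [Fintype ι] (a b : EuclideanSpace ℝ ι) :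
    IsCompact (box a b) := by
  have h : box a b = EuclideanSpace.equiv ι ℝ ⁻¹' Set.Icc (a : ι → ℝ) b := by
    ext P
    simp [box, Set.mem_Icc, Pi.le_def, forall_and]
  rw [h]
  exact (EuclideanSpace.equiv ι ℝ).toHomeomorph.isCompact_preimage.2 isCompact_Icc

variable {m : ℕ}

/-- Insert the value `c` as `i`-th coordinate. -/
def insertCoord (i : Fin (m + 1)) (c : ℝ) (Q : EuclideanSpace ℝ (Fin m)) :
    EuclideanSpace ℝ (Fin (m + 1)) :=
  WithLp.toLp 2 (i.insertNth c (Q : Fin m → ℝ))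

/-- Delete the `i`-th coordinate. -/
def removeCoord (i : Fin (m + 1)) (a : EuclideanSpace ℝ (Fin (m + 1))) :
    EuclideanSpace ℝ (Fin m) :=
  WithLp.toLp 2 fun j => a (i.succAbove j)

@[simp] theorem insertCoord_same (i : Fin (m + 1)) (c : ℝ) (Q : EuclideanSpace ℝ (Fin m)) :
    insertCoord i c Q i = c := by simp [insertCoord]

@[simp] theorem insertCoord_succAbove (i : Fin (m + 1)) (c : ℝ) (Q : EuclideanSpace ℝ (Fin m))
    (j : Fin m) : insertCoord i c Q (i.succAbove j) = Q j := by simp [insertCoord]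

@[simp] theorem removeCoord_apply (i : Fin (m + 1)) (a : EuclideanSpace ℝ (Fin (m + 1)))
    (j : Fin m) : removeCoord i a j = a (i.succAbove j) := rfl

theorem insertCoord_removeCoord (i : Fin (m + 1)) (P : EuclideanSpace ℝ (Fin (m + 1))) :
    insertCoord i (P i) (removeCoord i P) = P := by
  ext j
  revert j
  rw [Fin.forall_iff_succAbove i]
  simp

theorem insertCoord_sub_smul_single (i : Fin (m + 1)) (c t : ℝ) (Q : EuclideanSpace ℝ (Fin m)) :
    insertCoord i c Q - t • EuclideanSpace.single i 1 = insertCoord i (c - t) Q := by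
  ext j
  revert j
  rw [Fin.forall_iff_succAbove i]
  simp

theorem insertCoord_mem_box {i : Fin (m + 1)} {c : ℝ} {Q : EuclideanSpace ℝ (Fin m)}
    {a b : EuclideanSpace ℝ (Fin (m + 1))} :
    insertCoord i c Q ∈ box a b ↔
      c ∈ Set.Icc (a i) (b i) ∧ Q ∈ box (removeCoord i a) (removeCoord i b) := by
  simp [box, Fin.forall_iff_succAbove i]

theorem isometry_insertCoord (i : Fin (m + 1)) (c : ℝ) : Isometry (insertCoord i c) := by
  refine Isometry.of_dist_eq fun Q R => ?_
  simp [EuclideanSpace.dist_eq, Fin.sum_univ_succAbove _ i]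

theorem continuous_insertCoord (i : Fin (m + 1)) :
    Continuous fun z : ℝ × EuclideanSpace ℝ (Fin m) => insertCoord i z.1 z.2 := by
  refine (PiLp.continuous_toLp 2 _).comp (continuous_pi ?_)
  rw [Fin.forall_iff_succAbove i]
  simp only [Fin.insertNth_apply_same, Fin.insertNth_apply_succAbove]
  exact ⟨continuous_fst, fun j => by fun_prop⟩

theorem measurePreserving_insertCoord (i : Fin (m + 1)) :
    MeasurePreserving fun z : ℝ × EuclideanSpace ℝ (Fin m) => insertCoord i z.1 z.2 := by
  have h₁ : MeasurePreserving (Prod.map id WithLp.ofLp :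
      ℝ × EuclideanSpace ℝ (Fin m) → ℝ × (Fin m → ℝ)) :=
    (MeasurePreserving.id volume).prod (PiLp.volume_preserving_ofLp (Fin m))
  have h₂ := (volume_preserving_piFinSuccAbove (fun _ : Fin (m + 1) => ℝ) i).symm
  exact (PiLp.volume_preserving_toLp (Fin (m + 1))).comp (h₂.comp h₁)

theorem measurableEmbedding_insertCoord (i : Fin (m + 1)) :
    MeasurableEmbedding fun z : ℝ × EuclideanSpace ℝ (Fin m) => insertCoord i z.1 z.2 := by
  refine (continuous_insertCoord i).measurableEmbedding fun z w h => ?_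
  have h₁ : z.1 = w.1 := by simpa using congrArg (fun P => P i) h
  refine Prod.ext h₁ ?_
  ext j
  simpa using congrArg (fun P => P (i.succAbove j)) h

/-- The integral of `f (P - Y)` over the slice `P i = c` of a box, with respect to the Lebesgue
measure in the remaining coordinates. -/
noncomputable def sliceIntegral (f : EuclideanSpace ℝ (Fin (m + 1)) → ℝ)
    (a b : EuclideanSpace ℝ (Fin (m + 1))) (i : Fin (m + 1)) (c : ℝ)
    (Y : EuclideanSpace ℝ (Fin (m + 1))) : ℝ :=
  ∫ Q in box (removeCoord i a) (removeCoord i b), f (insertCoord i c Q - Y)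

variable {f : EuclideanSpace ℝ (Fin (m + 1)) → ℝ} {a b : EuclideanSpace ℝ (Fin (m + 1))}

theorem continuous_sliceIntegral (hf : Continuous f) (i : Fin (m + 1)) :
    Continuous fun z : ℝ × EuclideanSpace ℝ (Fin (m + 1)) =>
      sliceIntegral f a b i z.1 z.2 := by
  refine continuous_parametric_integral_of_continuous
    (f := fun (z : ℝ × EuclideanSpace ℝ (Fin (m + 1))) Q => f (insertCoord i z.1 Q - z.2)) ?_
    (isCompact_box _ _)
  have h := (continuous_insertCoord i).comp
    (f := fun w : (ℝ × EuclideanSpace ℝ (Fin (m + 1))) × EuclideanSpace ℝ (Fin m) =>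
      (w.1.1, w.2)) (by fun_prop)
  exact hf.comp (h.sub (by fun_prop))

theorem setIntegral_box_eq (hf : Continuous f) (i : Fin (m + 1)) (hab : a i ≤ b i)
    (Y : EuclideanSpace ℝ (Fin (m + 1))) :
    ∫ P in box a b, f (P - Y) = ∫ c in (a i)..(b i), sliceIntegral f a b i c Y := by
  have hpre : (fun z : ℝ × EuclideanSpace ℝ (Fin m) => insertCoord i z.1 z.2) ⁻¹' box a b
      = Set.Icc (a i) (b i) ×ˢ box (removeCoord i a) (removeCoord i b) := by
    ext z
    exact insertCoord_mem_box
  rw [← (measurePreserving_insertCoord i).setIntegral_preimage_emb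
    (measurableEmbedding_insertCoord i), hpre, Measure.volume_eq_prod, setIntegral_prod,
    intervalIntegral.integral_of_le hab, integral_Icc_eq_integral_Ioc]
  · rfl
  · refine ContinuousOn.integrableOn_compact (isCompact_Icc.prod (isCompact_box _ _)) ?_
    exact (hf.comp ((continuous_insertCoord i).sub continuous_const)).continuousOn

theorem hasDerivAt_setIntegral_box (hf : Continuous f) (i : Fin (m + 1)) (hab : a i ≤ b i)
    (Y : EuclideanSpace ℝ (Fin (m + 1))) (t : ℝ) :
    HasDerivAt (fun s : ℝ => ∫ P in box a b, f (P - (Y + s • EuclideanSpace.single i 1)))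
      (sliceIntegral f a b i (a i) (Y + t • EuclideanSpace.single i 1) -
        sliceIntegral f a b i (b i) (Y + t • EuclideanSpace.single i 1)) t := by
  have hshift : ∀ c s, sliceIntegral f a b i c (Y + s • EuclideanSpace.single i 1)
      = sliceIntegral f a b i (c - s) Y := by
    intro c s
    simp only [sliceIntegral]
    congr 1 with Q
    rw [← insertCoord_sub_smul_single]
    congr 1
    abel
  set H : ℝ → ℝ := fun c => sliceIntegral f a b i c Y with hH
  have hHc : Continuous H :=
    (continuous_sliceIntegral hf i).comp (f := fun c : ℝ => (c, Y)) (by fun_prop)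
  have hfun : (fun s : ℝ => ∫ P in box a b, f (P - (Y + s • EuclideanSpace.single i 1)))
      = fun s => (∫ c in (0 : ℝ)..(b i - s), H c) - ∫ c in (0 : ℝ)..(a i - s), H c := by
    funext s
    rw [setIntegral_box_eq hf i hab, intervalIntegral.integral_interval_sub_left
      (hHc.intervalIntegrable _ _) (hHc.intervalIntegrable _ _),
      ← intervalIntegral.integral_comp_sub_right]
    simp only [hshift, hH]
  have hG : ∀ e : ℝ, HasDerivAt (fun s => ∫ c in (0 : ℝ)..(e - s), H c) (-H (e - t)) t := by
    intro e
    have h₁ := (hHc.integral_hasStrictDerivAt 0 (e - t)).hasDerivAt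
    simpa [Function.comp_def] using h₁.comp t ((hasDerivAt_id t).const_sub e)
  rw [hfun, hshift, hshift]
  refine ((hG (b i)).sub (hG (a i))).congr_deriv ?_
  simp only [hH]
  ring

theorem hasFDerivAt_setIntegral_box (hf : Continuous f) (hab : ∀ i, a i ≤ b i)
    (X : EuclideanSpace ℝ (Fin (m + 1))) :
    HasFDerivAt (fun Y => ∫ P in box a b, f (P - Y))
      (∑ i, (sliceIntegral f a b i (a i) X - sliceIntegral f a b i (b i) X) •
        (EuclideanSpace.proj i : EuclideanSpace ℝ (Fin (m + 1)) →L[ℝ] ℝ)) X := by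
  refine hasFDerivAt_of_continuous_partials
    (L := fun i Y => sliceIntegral f a b i (a i) Y - sliceIntegral f a b i (b i) Y)
    (fun i => ?_) (fun i => hasDerivAt_setIntegral_box hf i (hab i)) X
  have h : ∀ c, Continuous fun Y => sliceIntegral f a b i c Y := fun c =>
    (continuous_sliceIntegral hf i).comp (f := fun Y => (c, Y)) (by fun_prop)
  exact (h _).sub (h _)

/-- Hausdorff measure on a Euclidean space is a positive multiple of Lebesgue measure. -/
theorem exists_hausdorffMeasure_eq_smul_volume (m : ℕ) :
    ∃ κ : NNReal, κ ≠ 0 ∧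
      (μH[m] : Measure (EuclideanSpace ℝ (Fin m))) = κ • (volume : Measure _) := by
  have : (μH[m] : Measure (EuclideanSpace ℝ (Fin m))).IsAddHaarMeasure := by
    simpa using isAddHaarMeasure_hausdorffMeasure (E := EuclideanSpace ℝ (Fin m))
  refine ⟨_, ?_, Measure.isAddLeftInvariant_eq_smul _ _⟩
  exact (Measure.addHaarScalarFactor_pos_of_isAddHaarMeasure _ _).ne'

theorem setIntegral_face_eq_smul_sliceIntegral {κ : NNReal}
    (hκ : (μH[m] : Measure (EuclideanSpace ℝ (Fin m))) = κ • (volume : Measure _))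
    (i : Fin (m + 1)) {c : ℝ} (hc : c ∈ Set.Icc (a i) (b i))
    (X : EuclideanSpace ℝ (Fin (m + 1))) :
    ∫ P in {P | P ∈ box a b ∧ P i = c}, f (P - X) ∂μH[m] = κ • sliceIntegral f a b i c X := by
  have hiso := isometry_insertCoord i c
  have hpre : insertCoord i c ⁻¹' {P | P ∈ box a b ∧ P i = c}
      = box (removeCoord i a) (removeCoord i b) := by
    ext Q
    simp [insertCoord_mem_box, hc.1, hc.2]
  have hsub : {P | P ∈ box a b ∧ P i = c} ⊆ Set.range (insertCoord i c) := by
    rintro P ⟨-, rfl⟩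
    exact ⟨removeCoord i P, insertCoord_removeCoord i P⟩
  rw [← Measure.restrict_restrict_of_subset hsub,
    ← hiso.map_hausdorffMeasure (Or.inl m.cast_nonneg),
    hiso.isClosedEmbedding.setIntegral_map, hpre, hκ, Measure.restrict_smul,
    integral_smul_nnreal_measure]
  rfl

end BoxFaceIntegral

open BoxFaceIntegral

theorem stmt_10 (n : ℕ) (hn : 1 ≤ n) (a b : EuclideanSpace ℝ (Fin n))
    (hab : ∀ i, a i < b i) (f : EuclideanSpace ℝ (Fin n) → ℝ) (hf : Continuous f) :
    -- `Σ^f_Ω` is differentiable everywhere, and `X` is a critical point iff for each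
    -- coordinate `i` the integrals of `f(P − X)` over the two opposite faces
    -- `{P ∈ Ω | P i = b i}` and `{P ∈ Ω | P i = a i}` (with their `(n−1)`-dimensional
    -- Lebesgue = Hausdorff measures) agree.
    (∀ X, DifferentiableAt ℝ
      (fun Y => ∫ P in {P : EuclideanSpace ℝ (Fin n) | ∀ i, a i ≤ P i ∧ P i ≤ b i},
        f (P - Y)) X) ∧
    ∀ X, fderiv ℝ
        (fun Y => ∫ P in {P : EuclideanSpace ℝ (Fin n) | ∀ i, a i ≤ P i ∧ P i ≤ b i},
          f (P - Y)) X = 0 ↔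
      ∀ i : Fin n,
        (∫ P in {P : EuclideanSpace ℝ (Fin n) |
            (∀ j, a j ≤ P j ∧ P j ≤ b j) ∧ P i = b i}, f (P - X) ∂μH[(n : ℝ) - 1]) =
        ∫ P in {P : EuclideanSpace ℝ (Fin n) |
            (∀ j, a j ≤ P j ∧ P j ≤ b j) ∧ P i = a i}, f (P - X) ∂μH[(n : ℝ) - 1] := by
  obtain ⟨m, rfl⟩ : ∃ m, n = m + 1 := ⟨n - 1, by omega⟩
  have hD := hasFDerivAt_setIntegral_box hf fun i => (hab i).le
  refine ⟨fun X => (hD X).differentiableAt, fun X => ?_⟩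
  obtain ⟨κ, hκ₀, hκ⟩ := exists_hausdorffMeasure_eq_smul_volume m
  have hdim : ((m + 1 : ℕ) : ℝ) - 1 = m := by simp
  have hface := fun (i : Fin (m + 1)) (c : ℝ) (hc : c ∈ Set.Icc (a i) (b i)) =>
    setIntegral_face_eq_smul_sliceIntegral (f := f) hκ i hc X
  have hiff : (∀ i, sliceIntegral f a b i (a i) X - sliceIntegral f a b i (b i) X = 0) ↔
      fderiv ℝ (fun Y => ∫ P in box a b, f (P - Y)) X = 0 := by
    rw [(hD X).fderiv]
    refine ⟨fun h => by simp [h], fun h i => ?_⟩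
    simpa [Pi.single_apply] using
      DFunLike.congr_fun h (EuclideanSpace.single i 1)
  refine hiff.symm.trans (forall_congr' fun i => ?_)
  rw [hdim]
  refine Iff.trans ?_ (Eq.congr (hface i (b i) (Set.right_mem_Icc.2 (hab i).le))
    (hface i (a i) (Set.left_mem_Icc.2 (hab i).le))).symm
  rw [smul_right_inj hκ₀, sub_eq_zero, eq_comm]
end
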